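/- arXiv:1901.00222 — 2 statements merged into one kernel-verified Lean document; each statement's English description precedes it below -/
import Mathlib

section
/- Let s be as in the context (any of the four cases), and let O₁ and O₂ be the ⟨s⟩-orbits in Δ of the roots α_m + ⋯ + α_{m+p+1} = e_m − e_{m+p+2} and α_{m+1} + ⋯ + α_{m+p+2} = e_{m+1} − e_{m+p+3}, respectively. Then O₁ ≠ O₂, and for every η ∈ (O₁ ∪ O₂) ∩ (Δ̄_K)₊ and all positive roots η₁, η₂ ∈ Δ₊ with η = η₁ + η₂, one has η₁, η₂ ∈ Δ_s ∪ Δ_{s^{−1}}; moreover it is not the case that both η₁ and η₂ lie in Δ_s, and not the case that both lie in Δ_{s^{−1}}. -/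
/- Common framework: type A_l root system realized in ℝ^{ℕ} (coordinates 1,…,l+1 used),
   the Weyl group as permutations of ℕ acting by permuting coordinates, and the
   Weyl group element s = s₁s₂ of Proposition 4.2 (all four parity cases). -/

noncomputable section

namespace DPW

/-- The ambient vector space (only coordinates 1,…,l+1 are used). -/
abbrev V : Type := ℕ → ℝ

/-- Standard basis vector e_i. -/
def evec (i : ℕ) : V := fun j => if j = i then 1 else 0

/-- The root e_i − e_j. -/
def rt (i j : ℕ) : V := evec i - evec j

/-- The root system Δ of type A_l. -/
def Delta (l : ℕ) : Set V :=
  {v | ∃ i j, 1 ≤ i ∧ i ≤ l + 1 ∧ 1 ≤ j ∧ j ≤ l + 1 ∧ i ≠ j ∧ v = rt i j}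

/-- Positive roots Δ₊. -/
def DeltaPos (l : ℕ) : Set V :=
  {v | ∃ i j, 1 ≤ i ∧ i < j ∧ j ≤ l + 1 ∧ v = rt i j}

/-- Negative roots Δ₋ = −Δ₊. -/
def DeltaNeg (l : ℕ) : Set V := {v | -v ∈ DeltaPos l}

/-- Action of a permutation on V : (σ·v)_j = v_{σ⁻¹(j)}. -/
def pact (σ : Equiv.Perm ℕ) (v : V) : V := fun j => v (σ⁻¹ j)

/-- row(e_a − e_b) = a. -/
def rowOf (v : V) : ℕ := sInf {a | v a = 1}

/-- col(e_a − e_b) = b. -/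
def colOf (v : V) : ℕ := sInf {b | v b = (-1 : ℝ)}

/-- Product of the simple reflections s_{α_i} = (i, i+1) for i in a list. -/
def swapProd (idxs : List ℕ) : Equiv.Perm ℕ :=
  (idxs.map (fun i => Equiv.swap i (i + 1))).prod

/-- The Weyl group element s = s₁s₂ (cases (i)–(iv) according to the parities of
    m = ⌊(l′−1)/2⌋ and l′; here p = l − l′ and s_γ = (m+1, m+p+2)). -/
def weylS (l l' : ℕ) : Equiv.Perm ℕ :=
  let m := (l' - 1) / 2
  let p := l - l'
  if m % 2 = 0 then
    if l' % 2 = 1 then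
      -- case (i)
      (swapProd (List.range' 2 (m / 2) 2) * swapProd (List.range' (m + p + 2) (m / 2) 2)) *
        (swapProd (List.range' 1 (m / 2) 2) * Equiv.swap (m + 1) (m + p + 2) *
          swapProd (List.range' (m + p + 3) (m / 2) 2))
    else
      -- case (ii)
      (swapProd (List.range' 2 (m / 2) 2) * swapProd (List.range' (m + p + 2) (m / 2 + 1) 2)) *
        (swapProd (List.range' 1 (m / 2) 2) * Equiv.swap (m + 1) (m + p + 2) *
          swapProd (List.range' (m + p + 3) (m / 2) 2))
  else
    if l' % 2 = 1 then
      -- case (iii)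
      (swapProd (List.range' 1 ((m + 1) / 2) 2) *
          swapProd (List.range' (m + p + 2) ((m + 1) / 2) 2)) *
        (swapProd (List.range' 2 ((m - 1) / 2) 2) * Equiv.swap (m + 1) (m + p + 2) *
          swapProd (List.range' (m + p + 3) ((m - 1) / 2) 2))
    else
      -- case (iv)
      (swapProd (List.range' 1 ((m + 1) / 2) 2) *
          swapProd (List.range' (m + p + 2) ((m + 1) / 2) 2)) *
        (swapProd (List.range' 2 ((m - 1) / 2) 2) * Equiv.swap (m + 1) (m + p + 2) *
          swapProd (List.range' (m + p + 3) ((m + 1) / 2) 2))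

/-- Δ_s = {α ∈ Δ₊ : sα ∈ Δ₋}. -/
def DeltaS (l : ℕ) (s : Equiv.Perm ℕ) : Set V :=
  {v ∈ DeltaPos l | pact s v ∈ DeltaNeg l}

/-- Δ_{s⁻¹} = {α ∈ Δ₊ : s⁻¹α ∈ Δ₋}. -/
def DeltaSinv (l : ℕ) (s : Equiv.Perm ℕ) : Set V :=
  {v ∈ DeltaPos l | pact s⁻¹ v ∈ DeltaNeg l}

/-- (Δ̄_K)₊ = {α ∈ Δ₊ : sα ≠ α}. -/
def DeltaKpos (l : ℕ) (s : Equiv.Perm ℕ) : Set V :=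
  {v ∈ DeltaPos l | pact s v ≠ v}

/-- (Δ̄_K)₋ = −(Δ̄_K)₊. -/
def DeltaKneg (l : ℕ) (s : Equiv.Perm ℕ) : Set V := {v | -v ∈ DeltaKpos l s}

/-- Δ^C = {α ∈ (Δ̄_K)₊ : row(sα) = row(α)}. -/
def DeltaC (l : ℕ) (s : Equiv.Perm ℕ) : Set V :=
  {v ∈ DeltaKpos l s | rowOf (pact s v) = rowOf v}

/-- Δ^R = {α ∈ (Δ̄_K)₊ : col(sα) = col(α)}. -/
def DeltaR (l : ℕ) (s : Equiv.Perm ℕ) : Set V :=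
  {v ∈ DeltaKpos l s | colOf (pact s v) = colOf v}

/-- Δ^O = (Δ̄_K)₊ \ (Δ^C ∪ Δ^R). -/
def DeltaO (l : ℕ) (s : Equiv.Perm ℕ) : Set V :=
  DeltaKpos l s \ (DeltaC l s ∪ DeltaR l s)

/-- Δ₁^O = {α ∈ Δ^O : row(α) ≥ m+p+2}. -/
def DeltaO1 (l : ℕ) (s : Equiv.Perm ℕ) (m p : ℕ) : Set V :=
  {v ∈ DeltaO l s | m + p + 2 ≤ rowOf v}

/-- Δ₂^O = {α ∈ Δ^O : col(α) ≤ m+1}. -/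
def DeltaO2 (l : ℕ) (s : Equiv.Perm ℕ) (m : ℕ) : Set V :=
  {v ∈ DeltaO l s | colOf v ≤ m + 1}

/-- Δ₃^O = Δ^O \ (Δ₁^O ∪ Δ₂^O). -/
def DeltaO3 (l : ℕ) (s : Equiv.Perm ℕ) (m p : ℕ) : Set V :=
  DeltaO l s \ (DeltaO1 l s m p ∪ DeltaO2 l s m)

/-- Δ̄_K^k = {α ∈ (Δ̄_K)₊ : s^{−j}α ∈ (Δ̄_K)₊ for 1 ≤ j ≤ k−1 and s^{−k}α ∈ (Δ̄_K)₋}. -/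
def DeltaKk (l : ℕ) (s : Equiv.Perm ℕ) (k : ℕ) : Set V :=
  {v ∈ DeltaKpos l s |
    (∀ j, 1 ≤ j → j ≤ k - 1 → pact (s⁻¹ ^ j) v ∈ DeltaKpos l s) ∧
      pact (s⁻¹ ^ k) v ∈ DeltaKneg l s}

/-- d(α) = min{k ≥ 1 : s^{−k}α ∈ Δ₋}. -/
def dd (l : ℕ) (s : Equiv.Perm ℕ) (v : V) : ℕ :=
  sInf {k | 1 ≤ k ∧ pact (s⁻¹ ^ k) v ∈ DeltaNeg l}

/-- Δ_Z = {e_i − e_j : m+2 ≤ i, j ≤ m+p+1, i ≠ j}. -/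
def DeltaZ (m p : ℕ) : Set V :=
  {v | ∃ i j, m + 2 ≤ i ∧ i ≤ m + p + 1 ∧ m + 2 ≤ j ∧ j ≤ m + p + 1 ∧ i ≠ j ∧ v = rt i j}

/-- The ⟨s⟩-orbit of a vector. -/
def orbitOf (s : Equiv.Perm ℕ) (v : V) : Set V := {w | ∃ n : ℤ, w = pact (s ^ n) v}

/-- The set P_κ (for κ ∈ Δ̄_K^k). -/
def Pk (l : ℕ) (s : Equiv.Perm ℕ) (k : ℕ) (κ : V) : Set (V × V) :=
  {q | (∃ i, 2 ≤ i ∧ i ≤ k - 1 ∧ q.1 ∈ DeltaKk l s i) ∧ q.2 ∈ DeltaKk l s k ∧ κ = q.1 + q.2}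

/-- The set P′_κ (for κ ∈ Δ̄_K^k). -/
def Pk' (l : ℕ) (s : Equiv.Perm ℕ) (k : ℕ) (κ : V) : Set (V × V) :=
  {q | q.1 ∈ DeltaKk l s k ∧ q.2 ∈ DeltaKk l s k ∧ κ = q.1 + q.2}

/-- The eigenvector v^λ of case (i) (m even, l′ = 2m+1 odd). -/
def vlam (m p : ℕ) (lam : ℂ) : ℕ → ℂ := fun j =>
  if j = 0 then 0
  else if j ≤ m + 1 then
    (if j % 2 = 1 then lam ^ ((4 * m + 5 - j) / 2) else lam ^ (j / 2))
  else if j ≤ m + p + 1 then 0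
  else if j ≤ m + p + m + 2 then
    (if (j - (m + p)) % 2 = 0 then lam ^ ((m + (j - (m + p))) / 2)
     else lam ^ ((3 * m + 5 - (j - (m + p))) / 2))
  else 0

/-- The explicit permutation of the indices induced by `weylS`: a rotation of the moving indices. -/
def zigzag (l m p x : ℕ) : ℕ :=
  if x = 0 then x
  else if x ≤ m + 1 then
    if x % 2 = m % 2 then (if x = 1 then 2 else if x = 2 then 1 else x - 2)
    else if x = m + 1 then m + p + 3 else x + 2
  else if x ≤ m + p + 1 then x
  else if x ≤ l + 1 then
    if (x - (m + p)) % 2 = 1 then (if x = l + 1 then l else if x = l then l + 1 else x + 2)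
    else if x = m + p + 2 then m else x - 2
  else x

theorem zigzag_cases (l m p x : ℕ) :
    ((x = 0 ∨ m + 2 ≤ x ∧ x ≤ m + p + 1 ∨ m + p + 1 < x ∧ l + 1 < x) ∧ zigzag l m p x = x) ∨
    (1 ≤ x ∧ x ≤ m ∧ x % 2 ≠ m % 2 ∧ zigzag l m p x = x + 2) ∨
    (x = m + 1 ∧ zigzag l m p x = m + p + 3) ∨
    (m + p + 3 ≤ x ∧ x + 1 ≤ l ∧ (x - (m + p)) % 2 = 1 ∧ zigzag l m p x = x + 2) ∨
    (m + p + 2 ≤ x ∧ x = l + 1 ∧ (x - (m + p)) % 2 = 1 ∧ zigzag l m p x = l) ∨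
    (m + p + 2 ≤ x ∧ x = l ∧ (x - (m + p)) % 2 = 1 ∧ zigzag l m p x = l + 1) ∨
    (x = 1 ∧ m % 2 = 1 ∧ zigzag l m p x = 2) ∨
    (x = 2 ∧ x ≤ m + 1 ∧ m % 2 = 0 ∧ zigzag l m p x = 1) ∨
    (3 ≤ x ∧ x ≤ m ∧ x % 2 = m % 2 ∧ zigzag l m p x = x - 2) ∨
    (x = m + p + 2 ∧ x ≤ l + 1 ∧ zigzag l m p x = m) ∨
    (m + p + 4 ≤ x ∧ x ≤ l + 1 ∧ (x - (m + p)) % 2 = 0 ∧ zigzag l m p x = x - 2) := by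
  unfold zigzag
  split_ifs <;> repeat first | (left; omega) | right | omega

theorem swapProd_range'_apply (a k x : ℕ) :
    swapProd (List.range' a k 2) x =
      if a ≤ x ∧ x < a + 2 * k then (if x % 2 = a % 2 then x + 1 else x - 1) else x := by
  induction k generalizing a with
  | zero => simp [swapProd]
  | succ k ih =>
    have h : swapProd (List.range' a (k + 1) 2) x =
        Equiv.swap a (a + 1) (swapProd (List.range' (a + 2) k 2) x) := by
      simp [swapProd, List.range'_succ]
    rw [h, ih, Equiv.swap_apply_def]
    split_ifs <;> omega

theorem swapProd_range'_cases (a k x : ℕ) :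
    (a ≤ x ∧ x < a + 2 * k ∧ x % 2 = a % 2 ∧ swapProd (List.range' a k 2) x = x + 1) ∨
    (a ≤ x ∧ x < a + 2 * k ∧ x % 2 ≠ a % 2 ∧ swapProd (List.range' a k 2) x = x - 1) ∨
    ((x < a ∨ a + 2 * k ≤ x) ∧ swapProd (List.range' a k 2) x = x) := by
  rw [swapProd_range'_apply]
  split_ifs <;> omega

theorem swap_cases (a b x : ℕ) :
    (x = a ∧ Equiv.swap a b x = b) ∨ (x = b ∧ Equiv.swap a b x = a) ∨
      (x ≠ a ∧ x ≠ b ∧ Equiv.swap a b x = x) := by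
  rw [Equiv.swap_apply_def]
  split_ifs <;> omega

set_option maxHeartbeats 4000000 in
/-- The product of the two alternating matchings of the moving indices, uniformly in parities. -/
theorem matching_mul_matching_apply {l m p a k₁ k₂ b k₃ k₄ : ℕ} (hm : 2 ≤ m)
    (hl : l = 2 * m + 1 + p ∨ l = 2 * m + 2 + p) (ha : 1 ≤ a ∧ a ≤ 2)
    (hb : 1 ≤ b ∧ b ≤ 2) (h₁ : a + 2 * k₁ = m + 2)
    (h₂ : l + 1 ≤ m + p + 2 + 2 * k₂ ∧ m + p + 2 + 2 * k₂ ≤ l + 2) (h₃ : b + 2 * k₃ = m + 1)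
    (h₄ : l + 1 ≤ m + p + 3 + 2 * k₄ ∧ m + p + 3 + 2 * k₄ ≤ l + 2) (x : ℕ) :
    ((swapProd (List.range' a k₁ 2) * swapProd (List.range' (m + p + 2) k₂ 2)) *
      (swapProd (List.range' b k₃ 2) * Equiv.swap (m + 1) (m + p + 2) *
        swapProd (List.range' (m + p + 3) k₄ 2))) x = zigzag l m p x := by
  simp only [Equiv.Perm.mul_apply]
  have e₁ := swapProd_range'_cases (m + p + 3) k₄ x
  generalize swapProd (List.range' (m + p + 3) k₄ 2) x = y₁ at *
  have e₂ := swap_cases (m + 1) (m + p + 2) y₁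
  generalize Equiv.swap (m + 1) (m + p + 2) y₁ = y₂ at *
  have e₃ := swapProd_range'_cases b k₃ y₂
  generalize swapProd (List.range' b k₃ 2) y₂ = y₃ at *
  have e₄ := swapProd_range'_cases (m + p + 2) k₂ y₃
  generalize swapProd (List.range' (m + p + 2) k₂ 2) y₃ = y₄ at *
  have e₅ := swapProd_range'_cases a k₁ y₄
  generalize swapProd (List.range' a k₁ 2) y₄ = y₅ at *
  have e := zigzag_cases l m p x
  generalize zigzag l m p x = z at *
  rcases e with e | e | e | e | e | e | e | e | e | e | e <;>
  rcases e₁ with e₁ | e₁ | e₁ <;> (try (exfalso; clear e₂ e₃ e₄ e₅; omega)) <;>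
  rcases e₂ with e₂ | e₂ | e₂ <;> (try (exfalso; clear e₃ e₄ e₅; omega)) <;>
  rcases e₃ with e₃ | e₃ | e₃ <;> (try (exfalso; clear e₄ e₅; omega)) <;>
  rcases e₄ with e₄ | e₄ | e₄ <;> (try (exfalso; clear e₅; omega)) <;>
  rcases e₅ with e₅ | e₅ | e₅ <;> omega

theorem weylS_apply {l l' m p : ℕ} (h5 : 5 ≤ l') (hll : l' ≤ l)
    (hm : m = (l' - 1) / 2) (hp : p = l - l') (x : ℕ) :
    weylS l l' x = zigzag l m p x := by
  unfold weylS
  simp only [← hm, ← hp]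
  split_ifs <;> apply matching_mul_matching_apply <;> omega

theorem pact_rt (s : Equiv.Perm ℕ) (i j : ℕ) : pact s (rt i j) = rt (s i) (s j) := by
  funext x
  simp [pact, rt, evec, Equiv.Perm.inv_def, Equiv.symm_apply_eq]

theorem neg_rt (i j : ℕ) : -rt i j = rt j i := by
  simp [rt]

theorem rt_injective {i j a b : ℕ} (hij : i ≠ j) (h : rt i j = rt a b) :
    i = a ∧ j = b := by
  have h1 := congrFun h i
  have h2 := congrFun h j
  simp only [rt, evec, Pi.sub_apply] at h1 h2
  constructor
  · by_contra hc
    simp only [hij, hc, if_true, if_false] at h1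
    split_ifs at h1 <;> norm_num at h1
  · by_contra hc
    simp only [hij.symm, hc, if_true, if_false] at h2
    split_ifs at h2 <;> norm_num at h2

theorem rt_eq_rt_add {i j b c d : ℕ} (hcd : c ≠ d)
    (h : rt i j = rt i b + rt c d) : b = c ∧ d = j := by
  have h' : rt b j = rt c d := by
    simp only [rt] at h ⊢
    linear_combination h
  obtain ⟨rfl, rfl⟩ := rt_injective hcd h'.symm
  exact ⟨rfl, rfl⟩

theorem rt_eq_add {i j a b c d : ℕ} (hij : i ≠ j) (hab : a ≠ b) (hcd : c ≠ d)
    (h : rt i j = rt a b + rt c d) : (a = i ∧ b = c ∧ d = j) ∨ (c = i ∧ d = a ∧ b = j) := by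
  have hi : i = a ∨ i = c := by
    by_contra! hc
    have := congrFun h i
    simp only [rt, evec, Pi.sub_apply, Pi.add_apply, hij, hc.1, hc.2, if_true, if_false] at this
    split_ifs at this <;> norm_num at this
  rcases hi with rfl | rfl
  · exact Or.inl ⟨rfl, rt_eq_rt_add hcd h⟩
  · rw [add_comm] at h
    exact Or.inr ⟨rfl, rt_eq_rt_add hab h⟩

theorem rt_mem_DeltaPos {l i j : ℕ} (hij : i ≠ j) :
    rt i j ∈ DeltaPos l ↔ 1 ≤ i ∧ i < j ∧ j ≤ l + 1 := by
  constructor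
  · rintro ⟨a, b, ha, hab, hb, h⟩
    obtain ⟨rfl, rfl⟩ := rt_injective hij h
    exact ⟨ha, hab, hb⟩
  · rintro ⟨hi, hlt, hj⟩
    exact ⟨i, j, hi, hlt, hj, rfl⟩

theorem rt_mem_DeltaNeg {l i j : ℕ} (hij : i ≠ j) :
    rt i j ∈ DeltaNeg l ↔ 1 ≤ j ∧ j < i ∧ i ≤ l + 1 := by
  rw [DeltaNeg, Set.mem_ofPred_eq, neg_rt, rt_mem_DeltaPos hij.symm]

theorem rt_mem_DeltaS {l i j : ℕ} (s : Equiv.Perm ℕ) (hij : i ≠ j) :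
    rt i j ∈ DeltaS l s ↔
      (1 ≤ i ∧ i < j ∧ j ≤ l + 1) ∧ 1 ≤ s j ∧ s j < s i ∧ s i ≤ l + 1 := by
  rw [DeltaS, Set.mem_sep_iff, pact_rt, rt_mem_DeltaPos hij,
    rt_mem_DeltaNeg (s.injective.ne hij)]

theorem DeltaSinv_eq (l : ℕ) (s : Equiv.Perm ℕ) : DeltaSinv l s = DeltaS l s⁻¹ := rfl

/-- Elements of the orbit of `rt a (s a)` are of the form `rt i (s i)`. -/
theorem exists_of_mem_orbitOf_rt_apply {s : Equiv.Perm ℕ} {a : ℕ} {v : V}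
    (h : v ∈ orbitOf s (rt a (s a))) : ∃ i, v = rt i (s i) := by
  obtain ⟨n, rfl⟩ := h
  refine ⟨(s ^ n) a, ?_⟩
  rw [pact_rt, ← Equiv.Perm.mul_apply, ← Equiv.Perm.mul_apply, ← zpow_add_one, ← zpow_one_add,
    add_comm]

/-- Elements of the orbit of `rt (s a) a` are of the form `rt (s i) i`. -/
theorem exists_of_mem_orbitOf_apply_rt {s : Equiv.Perm ℕ} {a : ℕ} {v : V}
    (h : v ∈ orbitOf s (rt (s a) a)) : ∃ i, v = rt (s i) i := by
  obtain ⟨n, rfl⟩ := h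
  refine ⟨(s ^ n) a, ?_⟩
  rw [pact_rt, ← Equiv.Perm.mul_apply, ← Equiv.Perm.mul_apply, ← zpow_add_one, ← zpow_one_add,
    add_comm]

theorem zigzag_mem {l m p x : ℕ} (hm : 2 ≤ m) (hl : l = 2 * m + 1 + p ∨ l = 2 * m + 2 + p)
    (h1 : 1 ≤ x) (h2 : x ≤ l + 1) : 1 ≤ zigzag l m p x ∧ zigzag l m p x ≤ l + 1 := by
  unfold zigzag
  split_ifs <;> omega

/-- An index `k` strictly inside an ascending step `i < zigzag i` of the rotation. -/
theorem zigzag_between_up {l m p i k j : ℕ} (hm : 2 ≤ m)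
    (hik : i < k) (hkj : k < j) (h : zigzag l m p i = j) :
    zigzag l m p k < j ∧ zigzag l m p k < zigzag l m p j := by
  have ei := zigzag_cases l m p i
  have ek := zigzag_cases l m p k
  have ej := zigzag_cases l m p j
  rw [h] at ei
  clear h
  generalize zigzag l m p k = k' at *
  generalize zigzag l m p j = j' at *
  rcases ei with e | e | e | e | e | e | e | e | e | e | e <;>
  (try (exfalso; clear ek ej; omega)) <;>
  rcases ek with ek | ek | ek | ek | ek | ek | ek | ek | ek | ek | ek <;>
  (try (exfalso; clear ej; omega)) <;> omega

/-- An index `zigzag y` strictly inside an ascending step `i < zigzag i` of the rotation. -/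
theorem zigzag_between_up' {l m p i x y j : ℕ} (hm : 2 ≤ m)
    (hl : l = 2 * m + 1 + p ∨ l = 2 * m + 2 + p)
    (hik : i < zigzag l m p y) (hkj : zigzag l m p y < j) (h : zigzag l m p i = j)
    (hx : zigzag l m p x = i) : i < y ∧ x < y := by
  have ei := zigzag_cases l m p i
  have ey := zigzag_cases l m p y
  have ex := zigzag_cases l m p x
  rw [h] at ei
  rw [hx] at ex
  clear h hx
  generalize zigzag l m p y = k at *
  rcases ei with e | e | e | e | e | e | e | e | e | e | e <;>
  (try (exfalso; clear ex ey; omega)) <;>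
  rcases ey with ey | ey | ey | ey | ey | ey | ey | ey | ey | ey | ey <;>
  (try (exfalso; clear ex; omega)) <;> omega

/-- An index `k` strictly inside a descending step `zigzag j < j` of the rotation. -/
theorem zigzag_between_down {l m p i k j : ℕ} (hm : 2 ≤ m)
    (hik : i < k) (hkj : k < j) (h : zigzag l m p j = i) :
    i < zigzag l m p k ∧ zigzag l m p i < zigzag l m p k := by
  have ej := zigzag_cases l m p j
  have ek := zigzag_cases l m p k
  have ei := zigzag_cases l m p i
  rw [h] at ej
  clear h
  generalize zigzag l m p k = k' at *
  generalize zigzag l m p i = i' at *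
  rcases ej with e | e | e | e | e | e | e | e | e | e | e <;>
  (try (exfalso; clear ek ei; omega)) <;>
  rcases ek with ek | ek | ek | ek | ek | ek | ek | ek | ek | ek | ek <;>
  (try (exfalso; clear ei; omega)) <;> omega

/-- An index `zigzag y` strictly inside a descending step `zigzag j < j` of the rotation. -/
theorem zigzag_between_down' {l m p i x y j : ℕ} (hm : 2 ≤ m)
    (hik : i < zigzag l m p y) (hkj : zigzag l m p y < j) (h : zigzag l m p j = i)
    (hx : zigzag l m p x = j) : y < j ∧ y < x := by
  have ej := zigzag_cases l m p j
  have ey := zigzag_cases l m p y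
  have ex := zigzag_cases l m p x
  rw [h] at ej
  rw [hx] at ex
  clear h hx
  generalize zigzag l m p y = k at *
  rcases ej with e | e | e | e | e | e | e | e | e | e | e <;>
  (try (exfalso; clear ex ey; omega)) <;>
  rcases ey with ey | ey | ey | ey | ey | ey | ey | ey | ey | ey | ey <;>
  (try (exfalso; clear ex; omega)) <;> omega

/-- Conclusion for a decomposition of an orbit root through an intermediate index `k`. -/
theorem inversion_dichotomy {l m p : ℕ} {s : Equiv.Perm ℕ} (hm : 2 ≤ m)
    (hl : l = 2 * m + 1 + p ∨ l = 2 * m + 2 + p) (hs : ∀ x, s x = zigzag l m p x)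
    {i k j : ℕ} (hi : 1 ≤ i) (hik : i < k) (hkj : k < j) (hj : j ≤ l + 1)
    (h : s i = j ∨ s j = i) :
    (rt i k ∈ DeltaS l s ∧ rt k j ∈ DeltaSinv l s ∧
        rt k j ∉ DeltaS l s ∧ rt i k ∉ DeltaSinv l s) ∨
      (rt k j ∈ DeltaS l s ∧ rt i k ∈ DeltaSinv l s ∧
        rt i k ∉ DeltaS l s ∧ rt k j ∉ DeltaSinv l s) := by
  have happ : ∀ x, s (s⁻¹ x) = x := s.apply_symm_apply
  have hinvapp : ∀ x, s⁻¹ (s x) = x := s.symm_apply_apply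
  have hmem : ∀ x, 1 ≤ x → x ≤ l + 1 → 1 ≤ s x ∧ s x ≤ l + 1 := fun x h1 h2 => by
    rw [hs]; exact zigzag_mem hm hl h1 h2
  have hmem' : ∀ x, 1 ≤ x → x ≤ l + 1 → 1 ≤ s⁻¹ x ∧ s⁻¹ x ≤ l + 1 := fun x h1 h2 => by
    have e := zigzag_cases l m p (s⁻¹ x)
    rw [← hs, happ] at e
    omega
  have hk' : zigzag l m p (s⁻¹ k) = k := by rw [← hs, happ]
  have mi := hmem i hi (by omega)
  have mk := hmem k (by omega) (by omega)
  have mj := hmem j (by omega) hj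
  have mi' := hmem' i hi (by omega)
  have mk' := hmem' k (by omega) (by omega)
  have mj' := hmem' j (by omega) hj
  simp only [DeltaSinv_eq, rt_mem_DeltaS _ hik.ne, rt_mem_DeltaS _ hkj.ne]
  rcases h with h | h
  · have hinv : s⁻¹ j = i := by rw [← h, hinvapp]
    have h₁ := zigzag_between_up hm hik hkj (by rw [← hs, h])
    have h₂ := zigzag_between_up' (y := s⁻¹ k) (x := s⁻¹ i) hm hl (by rwa [hk']) (by rwa [hk'])
      (by rw [← hs, h]) (by rw [← hs, happ])
    rw [← hs, ← hs] at h₁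
    omega
  · have hinv : s⁻¹ i = j := by rw [← h, hinvapp]
    have h₁ := zigzag_between_down hm hik hkj (by rw [← hs, h])
    have h₂ := zigzag_between_down' (y := s⁻¹ k) (x := s⁻¹ j) hm (by rwa [hk']) (by rwa [hk'])
      (by rw [← hs, h]) (by rw [← hs, happ])
    rw [← hs, ← hs] at h₁
    omega

/-- the ⟨s⟩-orbits O₁ of e_m − e_{m+p+2} and O₂ of e_{m+1} − e_{m+p+3}
are distinct, and if η ∈ (O₁ ∪ O₂) ∩ (Δ̄_K)₊ decomposes as η = η₁ + η₂ with
η₁, η₂ ∈ Δ₊, then η₁, η₂ ∈ Δ_s ∪ Δ_{s⁻¹}, not both in Δ_s, and not both in Δ_{s⁻¹}. -/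
theorem stmt14 (l l' m p : ℕ) (h5 : 5 ≤ l') (hll : l' ≤ l)
    (hm : m = (l' - 1) / 2) (hp : p = l - l') :
    let s := weylS l l'
    let O1 := orbitOf s (rt m (m + p + 2))
    let O2 := orbitOf s (rt (m + 1) (m + p + 3))
    O1 ≠ O2 ∧
      ∀ η ∈ (O1 ∪ O2) ∩ DeltaKpos l s, ∀ η₁ ∈ DeltaPos l, ∀ η₂ ∈ DeltaPos l,
        η = η₁ + η₂ →
          η₁ ∈ DeltaS l s ∪ DeltaSinv l s ∧ η₂ ∈ DeltaS l s ∪ DeltaSinv l s ∧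
            ¬(η₁ ∈ DeltaS l s ∧ η₂ ∈ DeltaS l s) ∧
            ¬(η₁ ∈ DeltaSinv l s ∧ η₂ ∈ DeltaSinv l s) := by
  intro s O1 O2
  have hs : ∀ x, s x = zigzag l m p x := weylS_apply h5 hll hm hp
  have hm2 : 2 ≤ m := by omega
  have hl : l = 2 * m + 1 + p ∨ l = 2 * m + 2 + p := by omega
  have hup : s (m + 1) = m + p + 3 := by
    rw [hs]
    have := zigzag_cases l m p (m + 1)
    omega
  have hdown : s (m + p + 2) = m := by
    rw [hs]
    have := zigzag_cases l m p (m + p + 2)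
    omega
  have hO1 : ∀ v ∈ O1, ∃ i, v = rt (s i) i := fun v hv =>
    exists_of_mem_orbitOf_apply_rt (a := m + p + 2) (by rwa [hdown])
  have hO2 : ∀ v ∈ O2, ∃ i, v = rt i (s i) := fun v hv =>
    exists_of_mem_orbitOf_rt_apply (a := m + 1) (by rwa [hup])
  constructor
  · intro h
    have h1 : rt m (m + p + 2) ∈ O2 := h ▸ ⟨0, by simp [pact_rt]⟩
    obtain ⟨i, hi⟩ := hO2 _ h1
    obtain ⟨rfl, h2⟩ := rt_injective (by omega) hi
    rw [hs] at h2
    have := zigzag_cases l m p m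
    omega
  · rintro η ⟨hη, ⟨i, j, hi, hij, hj, rfl⟩, -⟩ _ ⟨a, b, ha, hab, hb, rfl⟩ _
      ⟨c, d, hc, hcd, hd, rfl⟩ hsum
    have hstep : s i = j ∨ s j = i := by
      rcases hη with h | h
      · obtain ⟨x, hx⟩ := hO1 _ h
        obtain ⟨h1, rfl⟩ := rt_injective hij.ne hx
        exact Or.inr h1.symm
      · obtain ⟨x, hx⟩ := hO2 _ h
        obtain ⟨rfl, h1⟩ := rt_injective hij.ne hx
        exact Or.inl h1.symm
    simp only [Set.mem_union]
    rcases rt_eq_add hij.ne hab.ne hcd.ne hsum with ⟨rfl, rfl, rfl⟩ | ⟨rfl, rfl, rfl⟩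
    · have := inversion_dichotomy hm2 hl hs ha hab hcd hj hstep
      tauto
    · have := inversion_dichotomy hm2 hl hs hc hcd hab hj hstep
      tauto
end DPW
end
end

section
/- Let s be as in the context (any of the four cases). Let 2 ≤ k ≤ D+1, let η, η₁ ∈ Δ̄_K^k and η₂ ∈ (Δ̄_K^2 ∪ ⋯ ∪ Δ̄_K^{k−1}) ∪ (Δ̄_K^k ∩ Δ^O) with η = η₁ + η₂. If η₃ ∈ (Δ̄_K^2 ∪ ⋯ ∪ Δ̄_K^{k−1}) ∪ (Δ̄_K^k ∩ Δ^O) satisfies η + η₃ ∈ Δ, then η + η₃ ∉ Δ̄_K^k. -/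
/- Common framework: type A_l root system realized in ℝ^{ℕ} (coordinates 1,…,l+1 used),
   the Weyl group as permutations of ℕ acting by permuting coordinates, and the
   Weyl group element s = s₁s₂ of Proposition 4.2 (all four parity cases). -/

noncomputable section

namespace DPW

lemma swapProd_range' (n a i : ℕ) :
    swapProd (List.range' a n 2) i =
      if a ≤ i ∧ i < a + 2 * n then (if (i - a) % 2 = 0 then i + 1 else i - 1) else i := by
  induction n generalizing a with
  | zero => simp [swapProd]
  | succ n ih =>
    have h : swapProd (List.range' a (n + 1) 2) i =
        Equiv.swap a (a + 1) (swapProd (List.range' (a + 2) n 2) i) := by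
      simp [swapProd, List.range'_succ, Equiv.Perm.mul_apply]
    rw [h, ih, Equiv.swap_apply_def]
    split_ifs <;> omega

lemma swapProd_range'_of_notMem {n a i : ℕ} (h : i < a ∨ a + 2 * n ≤ i) :
    swapProd (List.range' a n 2) i = i := by
  rw [swapProd_range', if_neg (by omega)]

/-- The `r`-th point among those moved by `s`. -/
def movedPt (m p r : ℕ) : ℕ := if r ≤ m + 1 then r else r + p

/-- The involution of `{1, …, N}` exchanging `r` and `r + 1` whenever `r ≡ e` mod `2` and both
lie in the range. -/
def flipStep (N e r : ℕ) : ℕ :=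
  if r % 2 = e % 2 then (if r + 1 ≤ N then r + 1 else r) else (if 2 ≤ r then r - 1 else r)

lemma one_le_flipStep {N e r : ℕ} (h1 : 1 ≤ r) : 1 ≤ flipStep N e r := by
  unfold flipStep; split_ifs <;> omega

lemma flipStep_le {N e r : ℕ} (hr : r ≤ N) : flipStep N e r ≤ N := by
  unfold flipStep; split_ifs <;> omega

lemma swapProd_mul_swapProd_movedPt {N m p a n b k r : ℕ} (ha : 1 ≤ a) (ha' : a ≤ 2)
    (han : a + 2 * n = m + 2) (hb : b = m + p + 2) (hbk : N + p ≤ b + 2 * k)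
    (hbk' : b + 2 * k ≤ N + p + 1) (h1 : 1 ≤ r) (hr : r ≤ N) :
    (swapProd (List.range' a n 2) * swapProd (List.range' b k 2)) (movedPt m p r) =
      movedPt m p (flipStep N m r) := by
  rw [Equiv.Perm.mul_apply, swapProd_range' k, swapProd_range' n]
  unfold movedPt flipStep
  by_cases hm : r ≤ m + 1
  · rw [if_pos hm, if_neg (show ¬ (b ≤ r ∧ r < b + 2 * k) by omega)]
    split_ifs <;> omega
  · rw [if_neg hm]
    have : ∀ x, m + 2 ≤ x → (if a ≤ x ∧ x < a + 2 * n then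
        (if (x - a) % 2 = 0 then x + 1 else x - 1) else x) = x :=
      fun x hx => if_neg (by omega)
    rw [this]
    · split_ifs <;> omega
    · split_ifs <;> omega

lemma swapProd_mul_swap_mul_swapProd_movedPt {N m p a n b k r : ℕ} (hm : 1 ≤ m)
    (ha : 1 ≤ a) (ha' : a ≤ 2)
    (han : a + 2 * n = m + 1) (hb : b = m + p + 3) (hbk : N + p ≤ b + 2 * k)
    (hbk' : b + 2 * k ≤ N + p + 1) (h1 : 1 ≤ r) (hr : r ≤ N) :
    (swapProd (List.range' a n 2) * Equiv.swap (m + 1) (m + p + 2) *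
      swapProd (List.range' b k 2)) (movedPt m p r) = movedPt m p (flipStep N (m + 1) r) := by
  rw [Equiv.Perm.mul_apply, Equiv.Perm.mul_apply]
  have hN : m + 2 ≤ N := by omega
  rcases lt_trichotomy r (m + 1) with h | h | h
  · have e : movedPt m p r = r := if_pos h.le
    rw [e, swapProd_range'_of_notMem (n := k) (by omega),
      Equiv.swap_apply_of_ne_of_ne (by omega) (by omega), swapProd_range']
    unfold movedPt flipStep
    split_ifs <;> omega
  · have e : movedPt m p r = m + 1 := by rw [← h]; exact if_pos h.le
    have e' : flipStep N (m + 1) r = m + 2 := by unfold flipStep; split_ifs <;> omega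
    rw [e, e', swapProd_range'_of_notMem (n := k) (by omega), Equiv.swap_apply_left,
      swapProd_range'_of_notMem (by omega)]
    unfold movedPt
    split_ifs <;> omega
  · rcases eq_or_lt_of_le (show m + 2 ≤ r by omega) with h' | h'
    · have e : movedPt m p r = m + p + 2 := by unfold movedPt; split_ifs <;> omega
      have e' : flipStep N (m + 1) r = m + 1 := by unfold flipStep; split_ifs <;> omega
      rw [e, e', swapProd_range'_of_notMem (n := k) (by omega), Equiv.swap_apply_right,
        swapProd_range'_of_notMem (by omega)]
      unfold movedPt
      split_ifs <;> omega
    · have e : movedPt m p r = r + p := if_neg (by omega)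
      have e' : swapProd (List.range' b k 2) (r + p) = movedPt m p (flipStep N (m + 1) r) := by
        rw [swapProd_range']
        unfold movedPt flipStep
        split_ifs <;> omega
      have e'' : m + p + 3 ≤ movedPt m p (flipStep N (m + 1) r) := by
        unfold movedPt flipStep
        split_ifs <;> omega
      rw [e, e', Equiv.swap_apply_of_ne_of_ne (by omega) (by omega),
        swapProd_range'_of_notMem (by omega)]

lemma weylS_movedPt {l l' m p r : ℕ} (h5 : 5 ≤ l')
    (hm : m = (l' - 1) / 2) (hp : p = l - l') (h1 : 1 ≤ r) (hr : r ≤ l' + 1) :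
    weylS l l' (movedPt m p r) =
      movedPt m p (flipStep (l' + 1) m (flipStep (l' + 1) (m + 1) r)) := by
  unfold weylS
  simp only [← hm, ← hp]
  split_ifs <;>
    rw [Equiv.Perm.mul_apply, swapProd_mul_swap_mul_swapProd_movedPt (N := l' + 1),
      swapProd_mul_swapProd_movedPt (N := l' + 1)] <;>
    first
      | omega
      | exact one_le_flipStep h1
      | exact flipStep_le hr

lemma weylS_fixed {l l' m p i : ℕ}
    (hm : m = (l' - 1) / 2) (hp : p = l - l') (h1 : m + 2 ≤ i) (hi : i ≤ m + p + 1) :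
    weylS l l' i = i := by
  unfold weylS
  simp only [← hm, ← hp]
  have hswap : Equiv.swap (m + 1) (m + p + 2) i = i :=
    Equiv.swap_apply_of_ne_of_ne (by omega) (by omega)
  split_ifs <;>
    simp (disch := omega) only [Equiv.Perm.mul_apply, swapProd_range'_of_notMem, hswap]

/-- A lift to `ℤ` (modulo `2 * N`) of the angle at which `i` sits on the circle that `s` rotates:
`s` increases angles by `2`. -/
def angle (m p i : ℕ) : ℤ :=
  if i ≤ m + 1 then (if i % 2 = (m + 1) % 2 then i else 1 - i)
  else (if (i - p) % 2 = (m + 1) % 2 then (i : ℤ) - p else 1 - ((i : ℤ) - p))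

/-- The point of the line `{1, …, N}` at angle `t ∈ (-3 * N, N]`. -/
def angleHt (N : ℕ) (t : ℤ) : ℕ :=
  (if 0 < t then t else if -N < t then 1 - t else if -2 * N < t then t + 2 * N
    else 1 - t - 2 * N).toNat

lemma flipStep_angleHt {N e : ℕ} {t : ℤ} (ht : (t - e) % 2 = 0)
    (h1 : -3 * N < t) (h2 : t + 1 ≤ N) :
    flipStep N e (angleHt N t) = angleHt N (t + 1) := by
  have hspec : ∀ x : ℤ, -3 * N < x → x ≤ N →
      0 < x ∧ (angleHt N x : ℤ) = x ∨ x ≤ 0 ∧ -N < x ∧ (angleHt N x : ℤ) = 1 - x ∨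
      x ≤ -N ∧ -2 * N < x ∧ (angleHt N x : ℤ) = x + 2 * N ∨
      x ≤ -2 * N ∧ (angleHt N x : ℤ) = 1 - x - 2 * N := by
    intro x hx hx'
    unfold angleHt
    split_ifs <;> omega
  have ha := hspec t h1 (by omega)
  have hb := hspec (t + 1) (by omega) (by omega)
  generalize angleHt N t = r at *
  generalize angleHt N (t + 1) = q at *
  unfold flipStep
  rcases ha with ha | ha | ha | ha <;> split_ifs <;> omega

lemma angleHt_pos {N : ℕ} {t : ℤ} (h1 : -3 * N < t) (h2 : t ≤ N) :
    1 ≤ angleHt N t ∧ angleHt N t ≤ N := by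
  unfold angleHt; split_ifs <;> omega

lemma movedPt_angleHt_angle {l l' m p i : ℕ} (h5 : 5 ≤ l') (hll : l' ≤ l)
    (hm : m = (l' - 1) / 2) (hp : p = l - l') (h1 : 1 ≤ i) (hi : i ≤ l + 1)
    (hZ : ¬ (m + 2 ≤ i ∧ i ≤ m + p + 1)) :
    movedPt m p (angleHt (l' + 1) (angle m p i)) = i := by
  unfold movedPt angleHt angle
  split_ifs <;> omega

lemma angle_bounds {l l' m p i : ℕ} (h5 : 5 ≤ l') (hll : l' ≤ l)
    (hm : m = (l' - 1) / 2) (hp : p = l - l') (h1 : 1 ≤ i) (hi : i ≤ l + 1)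
    (hZ : ¬ (m + 2 ≤ i ∧ i ≤ m + p + 1)) :
    -((l' : ℤ) + 1) < angle m p i ∧ angle m p i ≤ l' + 1 ∧
      (angle m p i - (m + 1)) % 2 = 0 := by
  unfold angle
  split_ifs <;> omega

lemma weylS_inv_pow_fixed {l l' m p i : ℕ}
    (hm : m = (l' - 1) / 2) (hp : p = l - l') (h1 : m + 2 ≤ i) (hi : i ≤ m + p + 1) (j : ℕ) :
    ((weylS l l')⁻¹ ^ j) i = i := by
  induction j with
  | zero => rfl
  | succ j ih =>
    rw [pow_succ', Equiv.Perm.mul_apply, ih, Equiv.Perm.inv_eq_iff_eq, weylS_fixed hm hp h1 hi]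

lemma weylS_inv_pow_movedPt {l l' m p : ℕ} (h5 : 5 ≤ l')
    (hm : m = (l' - 1) / 2) (hp : p = l - l') {t : ℤ} (ht : (t - (m + 1)) % 2 = 0)
    (h2 : t ≤ l' + 1) (j : ℕ) (hj : -3 * ((l' : ℤ) + 1) < t - 2 * j) :
    ((weylS l l')⁻¹ ^ j) (movedPt m p (angleHt (l' + 1) t)) =
      movedPt m p (angleHt (l' + 1) (t - 2 * j)) := by
  induction j with
  | zero => simp
  | succ j ih =>
    push_cast at hj
    have hpos := angleHt_pos (N := l' + 1) (t := t - 2 * (j + 1)) (by push_cast; omega)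
      (by push_cast; omega)
    rw [pow_succ', Equiv.Perm.mul_apply, ih (by omega), Equiv.Perm.inv_eq_iff_eq]
    push_cast
    rw [weylS_movedPt h5 hm hp hpos.1 hpos.2,
      flipStep_angleHt (by push_cast; omega) (by push_cast; omega) (by push_cast; omega),
      flipStep_angleHt (by omega) (by push_cast; omega) (by push_cast; omega)]
    congr 2
    ring

lemma weylS_inv_pow_angle {l l' m p i : ℕ} (h5 : 5 ≤ l') (hll : l' ≤ l)
    (hm : m = (l' - 1) / 2) (hp : p = l - l') (h1 : 1 ≤ i) (hi : i ≤ l + 1)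
    (hZ : ¬ (m + 2 ≤ i ∧ i ≤ m + p + 1)) (j : ℕ)
    (hj : -3 * ((l' : ℤ) + 1) < angle m p i - 2 * j) :
    ((weylS l l')⁻¹ ^ j) i = movedPt m p (angleHt (l' + 1) (angle m p i - 2 * j)) := by
  have hb := angle_bounds h5 hll hm hp h1 hi hZ
  rw [← weylS_inv_pow_movedPt h5 hm hp hb.2.2 hb.2.1 j hj,
    movedPt_angleHt_angle h5 hll hm hp h1 hi hZ]

lemma movedPt_lt_movedPt {m p r q : ℕ} : movedPt m p r < movedPt m p q ↔ r < q := by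
  unfold movedPt; split_ifs <;> omega

/-- The combinatorial content of `rt a b ∈ DeltaKk l s k`. -/
structure IsLevel (l m p : ℕ) (s : Equiv.Perm ℕ) (k a b : ℕ) : Prop where
  one_le : 1 ≤ a
  lt : a < b
  le : b ≤ l + 1
  not_fixed : ¬ ((m + 2 ≤ a ∧ a ≤ m + p + 1) ∧ (m + 2 ≤ b ∧ b ≤ m + p + 1))
  pos : ∀ j, 1 ≤ j → j ≤ k - 1 → (s⁻¹ ^ j) a < (s⁻¹ ^ j) b
  neg : (s⁻¹ ^ k) b < (s⁻¹ ^ k) a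

lemma angleHt_lt_iff {N : ℕ} {t u : ℤ} (ht : -3 * N < t) (ht' : t ≤ N)
    (hu : -3 * N < u) (hu' : u ≤ N) (htu : (t - u) % 2 = 0)
    (h1 : t - u < 2 * N) (h2 : u - t < 2 * N) :
    angleHt N t < angleHt N u ↔
      (t < u ∧ (0 < t + u - 1 ∨ -4 * N < t + u - 1 ∧ t + u - 1 < -2 * N)) ∨
      (u < t ∧ (-2 * N < t + u - 1 ∧ t + u - 1 < 0 ∨ t + u - 1 < -4 * N)) := by
  unfold angleHt
  split_ifs <;> omega

/-- A pair of moved points changes its order when the sum of the angles crosses the axis. -/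
lemma IsLevel.angle_moved {l l' m p k a b : ℕ} (h5 : 5 ≤ l') (hll : l' ≤ l)
    (hm : m = (l' - 1) / 2) (hp : p = l - l') (hk : 1 ≤ k)
    (h : IsLevel l m p (weylS l l') k a b)
    (ha : ¬ (m + 2 ≤ a ∧ a ≤ m + p + 1)) (hb : ¬ (m + 2 ≤ b ∧ b ≤ m + p + 1)) :
    (angle m p a < angle m p b ∧ 4 * (k : ℤ) - 4 < angle m p a + angle m p b - 1 ∧
        angle m p a + angle m p b - 1 < 4 * k) ∨
      (angle m p b < angle m p a ∧ angle m p a + angle m p b - 1 < 0 ∧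
        4 * (k : ℤ) - 4 < angle m p a + angle m p b - 1 + 2 * (l' + 1) ∧
        angle m p a + angle m p b - 1 + 2 * (l' + 1) < 4 * k) := by
  obtain ⟨h1, hlt, hle, -, hpos, hneg⟩ := h
  have ea := weylS_inv_pow_angle h5 hll hm hp h1 (by omega) ha
  have eb := weylS_inv_pow_angle h5 hll hm hp (by omega) hle hb
  obtain ⟨a1, a2, a3⟩ := angle_bounds h5 hll hm hp h1 (by omega) ha
  obtain ⟨b1, b2, b3⟩ := angle_bounds h5 hll hm hp (by omega) hle hb
  generalize angle m p a = t at *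
  generalize angle m p b = u at *
  have h0 : ∀ j : ℕ, -3 * ((l' : ℤ) + 1) < t - 2 * j → -3 * ((l' : ℤ) + 1) < u - 2 * j →
      ((((weylS l l')⁻¹ ^ j) a < ((weylS l l')⁻¹ ^ j) b) ↔
        angleHt (l' + 1) (t - 2 * j) < angleHt (l' + 1) (u - 2 * j)) := by
    intro j hj hj'
    rw [ea j hj, eb j hj', movedPt_lt_movedPt]
  have h0' := (h0 0 (by omega) (by omega)).1 (by simpa using hlt)
  rw [angleHt_lt_iff (by push_cast; omega) (by push_cast; omega) (by push_cast; omega)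
    (by push_cast; omega) (by omega) (by push_cast; omega) (by push_cast; omega)] at h0'
  push_cast at h0'
  have hstep : ∃ j : ℕ, 1 ≤ j ∧ ((0 < t + u - 1 ∧ t + u - 1 < 4 * j ∧ 4 * (j : ℤ) - 4 < t + u - 1) ∨
      (t + u - 1 < 0 ∧ t + u - 1 + 2 * (l' + 1) < 4 * j ∧
        4 * (j : ℤ) - 4 < t + u - 1 + 2 * (l' + 1))) := by
    rcases lt_or_ge 0 (t + u - 1) with hx | hx
    · exact ⟨((t + u - 1 + 3) / 4).toNat, by omega, by omega⟩
    · exact ⟨((t + u - 1 + 2 * (l' + 1) + 3) / 4).toNat, by omega, by omega⟩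
  obtain ⟨j, hj1, hj⟩ := hstep
  have hkj : k ≤ j := by
    by_contra hlt'
    have := (h0 j (by omega) (by omega)).1 (hpos j hj1 (by omega))
    rw [angleHt_lt_iff (by push_cast; omega) (by push_cast; omega) (by push_cast; omega)
      (by push_cast; omega) (by omega) (by push_cast; omega) (by push_cast; omega)] at this
    push_cast at this
    omega
  have hk' := mt (h0 k (by omega) (by omega)).2 hneg.not_gt
  rw [angleHt_lt_iff (by push_cast; omega) (by push_cast; omega) (by push_cast; omega)
    (by push_cast; omega) (by omega) (by push_cast; omega) (by push_cast; omega)] at hk'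
  push_cast at hk'
  omega

lemma IsLevel.angle_left {l l' m p k a b : ℕ} (h5 : 5 ≤ l') (hll : l' ≤ l)
    (hm : m = (l' - 1) / 2) (hp : p = l - l') (hk : 1 ≤ k)
    (h : IsLevel l m p (weylS l l') k a b) (hb : m + 2 ≤ b ∧ b ≤ m + p + 1) :
    ¬ (m + 2 ≤ a ∧ a ≤ m + p + 1) ∧ -(m : ℤ) ≤ angle m p a - 2 * (k - 1) ∧
      angle m p a - 2 * k < -m ∧ angle m p a ≤ m + 1 := by
  obtain ⟨h1, hlt, hle, hn, hpos, hneg⟩ := h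
  have ha : ¬ (m + 2 ≤ a ∧ a ≤ m + p + 1) := fun h => hn ⟨h, hb⟩
  refine ⟨ha, ?_⟩
  have hbnd : -(m : ℤ) ≤ angle m p a ∧ angle m p a ≤ m + 1 := by
    unfold angle; split_ifs <;> omega
  have ea := weylS_inv_pow_angle h5 hll hm hp h1 (by omega) ha
  have eb := weylS_inv_pow_fixed (l := l) hm hp hb.1 hb.2
  obtain ⟨a1, a2, a3⟩ := angle_bounds h5 hll hm hp h1 (by omega) ha
  generalize angle m p a = t at *
  have hht : ∀ j : ℕ, t - 2 * j < -m → -(m : ℤ) ≤ t - 2 * j + 2 →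
      b < movedPt m p (angleHt (l' + 1) (t - 2 * j)) := by
    intro j hj hj'
    unfold movedPt angleHt
    split_ifs <;> omega
  obtain ⟨j, hj1, hj, hj'⟩ : ∃ j : ℕ, 1 ≤ j ∧ t - 2 * j < -m ∧ -(m : ℤ) ≤ t - 2 * j + 2 :=
    ⟨((t + m) / 2 + 1).toNat, by omega, by omega, by omega⟩
  have hkj : k ≤ j := by
    by_contra hlt'
    have := hpos j hj1 (by omega)
    rw [ea j (by omega), eb] at this
    have := hht j hj hj'
    omega
  rw [ea k (by omega), eb] at hneg
  have : t - 2 * k < -m := by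
    by_contra hge
    have : movedPt m p (angleHt (l' + 1) (t - 2 * k)) ≤ m + 1 := by
      unfold movedPt angleHt
      split_ifs <;> omega
    omega
  omega

lemma IsLevel.angle_right {l l' m p k a b : ℕ} (h5 : 5 ≤ l') (hll : l' ≤ l)
    (hm : m = (l' - 1) / 2) (hp : p = l - l') (hk : 1 ≤ k)
    (h : IsLevel l m p (weylS l l') k a b) (ha : m + 2 ≤ a ∧ a ≤ m + p + 1) :
    ¬ (m + 2 ≤ b ∧ b ≤ m + p + 1) ∧
      ((m + 2 ≤ angle m p b ∧ m + 2 ≤ angle m p b - 2 * (k - 1) ∧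
        angle m p b - 2 * k < m + 2) ∨
       (angle m p b ≤ -(m : ℤ) - 1 ∧ m + 2 ≤ angle m p b + 2 * (l' + 1) - 2 * (k - 1) ∧
        angle m p b + 2 * (l' + 1) - 2 * k < m + 2)) := by
  obtain ⟨h1, hlt, hle, hn, hpos, hneg⟩ := h
  have hb : ¬ (m + 2 ≤ b ∧ b ≤ m + p + 1) := fun h => hn ⟨ha, h⟩
  refine ⟨hb, ?_⟩
  have hbnd : m + 2 ≤ angle m p b ∨ angle m p b ≤ -(m : ℤ) - 1 := by
    unfold angle; split_ifs <;> omega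
  have eb := weylS_inv_pow_angle h5 hll hm hp (by omega) hle hb
  have ea := weylS_inv_pow_fixed (l := l) hm hp ha.1 ha.2
  obtain ⟨a1, a2, a3⟩ := angle_bounds h5 hll hm hp (by omega) hle hb
  generalize angle m p b = t at *
  obtain ⟨u, hu, hu1, hu2⟩ : ∃ u : ℤ, (m + 2 ≤ t ∧ u = t ∨ t ≤ -(m : ℤ) - 1 ∧ u = t + 2 * (l' + 1)) ∧
      m + 2 ≤ u ∧ u ≤ 2 * (l' + 1) - m - 1 := by
    rcases hbnd with h | h
    · exact ⟨t, Or.inl ⟨h, rfl⟩, by omega, by omega⟩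
    · exact ⟨t + 2 * (l' + 1), Or.inr ⟨h, rfl⟩, by omega, by omega⟩
  have hht : ∀ j : ℕ, u - 2 * j < m + 2 → m + 2 ≤ u - 2 * j + 2 →
      movedPt m p (angleHt (l' + 1) (t - 2 * j)) < a := by
    intro j hj hj'
    unfold movedPt angleHt
    rcases hu with hu | hu <;> split_ifs <;> omega
  obtain ⟨j, hj1, hj, hj'⟩ : ∃ j : ℕ, 1 ≤ j ∧ u - 2 * j < m + 2 ∧ m + 2 ≤ u - 2 * j + 2 :=
    ⟨((u - (m + 2)) / 2 + 1).toNat, by omega, by omega, by omega⟩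
  have hkj : k ≤ j := by
    by_contra hlt'
    have := hpos j hj1 (by omega)
    rw [eb j (by omega), ea] at this
    have := hht j hj hj'
    omega
  rw [eb k (by omega), ea] at hneg
  have : u - 2 * k < m + 2 := by
    by_contra hge
    have : m + p + 2 ≤ movedPt m p (angleHt (l' + 1) (t - 2 * k)) := by
      unfold movedPt angleHt
      rcases hu with hu | hu <;> split_ifs <;> omega
    omega
  omega

lemma rt_apply (a b j : ℕ) :
    rt a b j = (if j = a then 1 else 0) - (if j = b then 1 else 0) := rfl

lemma pact_rt_s17 (σ : Equiv.Perm ℕ) (a b : ℕ) : pact σ (rt a b) = rt (σ a) (σ b) := by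
  funext j
  simp only [pact, rt_apply, Equiv.Perm.inv_eq_iff_eq]

lemma neg_rt_s17 (a b : ℕ) : -rt a b = rt b a := by simp [rt]

lemma rt_inj {a b c d : ℕ} (hab : a ≠ b) (h : rt a b = rt c d) : a = c ∧ b = d := by
  have ha := congrFun h a
  have hb := congrFun h b
  simp only [rt_apply] at ha hb
  constructor
  · by_contra hne
    split_ifs at ha <;> first | omega | norm_num at ha
  · by_contra hne
    split_ifs at hb <;> first | omega | norm_num at hb

lemma rt_add_rt {a b c d e f : ℕ} (hab : a ≠ b) (hcd : c ≠ d) (hef : e ≠ f)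
    (h : rt e f = rt a b + rt c d) : b = c ∧ e = a ∧ f = d ∨ a = d ∧ e = c ∧ f = b := by
  have key : ∀ j, (if j = e then (1 : ℤ) else 0) - (if j = f then 1 else 0) =
      (if j = a then 1 else 0) - (if j = b then 1 else 0) +
        ((if j = c then 1 else 0) - (if j = d then 1 else 0)) := by
    intro j
    have := congrFun h j
    simp only [Pi.add_apply, rt_apply] at this
    exact_mod_cast this
  have ha := key a
  have hb := key b
  have hc := key c
  have hd := key d
  have he := key e
  by_cases h1 : b = c
  · grind
  · by_cases h2 : a = d
    · grind
    · exfalso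
      grind

lemma rowOf_rt {a b : ℕ} (hab : a ≠ b) : rowOf (rt a b) = a := by
  have : {x | rt a b x = 1} = {a} := by
    ext x
    simp only [Set.mem_ofPred_eq, rt_apply, Set.mem_singleton_iff]
    split_ifs <;> first | (subst_vars; simp_all; done) | (norm_num; try assumption)
  rw [rowOf, this, csInf_singleton]

lemma colOf_rt {a b : ℕ} (hab : a ≠ b) : colOf (rt a b) = b := by
  have : {x | rt a b x = (-1 : ℝ)} = {b} := by
    ext x
    simp only [Set.mem_ofPred_eq, rt_apply, Set.mem_singleton_iff]
    split_ifs <;> first | (subst_vars; simp_all; done) | (norm_num; try assumption)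
  rw [colOf, this, csInf_singleton]

lemma rt_mem_DeltaPos_s17 {l a b : ℕ} (h : rt a b ∈ DeltaPos l) (hab : a ≠ b) :
    1 ≤ a ∧ a < b ∧ b ≤ l + 1 := by
  obtain ⟨i, j, h1, h2, h3, h4⟩ := h
  obtain ⟨rfl, rfl⟩ := rt_inj hab h4
  exact ⟨h1, h2, h3⟩

lemma exists_isLevel {l l' m p k : ℕ} (hm : m = (l' - 1) / 2) (hp : p = l - l') {v : V}
    (h : v ∈ DeltaKk l (weylS l l') k) :
    ∃ a b, v = rt a b ∧ IsLevel l m p (weylS l l') k a b := by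
  obtain ⟨⟨⟨a, b, h1, hlt, hle, rfl⟩, hmv⟩, hpos, hneg⟩ := h
  refine ⟨a, b, rfl, h1, hlt, hle, ?_, ?_, ?_⟩
  · rintro ⟨ha, hb⟩
    exact hmv (by rw [pact_rt_s17, weylS_fixed hm hp ha.1 ha.2, weylS_fixed hm hp hb.1 hb.2])
  · intro j hj hj'
    have := (hpos j hj hj').1
    rw [pact_rt_s17] at this
    exact (rt_mem_DeltaPos_s17 this (by simpa using hlt.ne)).2.1
  · have := hneg.1
    rw [pact_rt_s17, neg_rt_s17] at this
    exact (rt_mem_DeltaPos_s17 this (by simpa using hlt.ne')).2.1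

lemma not_fixed_of_mem_DeltaO {l l' m p a b : ℕ} (hm : m = (l' - 1) / 2) (hp : p = l - l')
    (hab : a ≠ b) (h : rt a b ∈ DeltaO l (weylS l l')) :
    ¬ (m + 2 ≤ a ∧ a ≤ m + p + 1) ∧ ¬ (m + 2 ≤ b ∧ b ≤ m + p + 1) := by
  have hs : weylS l l' a ≠ weylS l l' b := by simpa using hab
  refine ⟨fun ha => h.2 (Or.inl ⟨h.1, ?_⟩), fun hb => h.2 (Or.inr ⟨h.1, ?_⟩)⟩
  · rw [pact_rt_s17, rowOf_rt hs, rowOf_rt hab, weylS_fixed hm hp ha.1 ha.2]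
  · rw [pact_rt_s17, colOf_rt hs, colOf_rt hab, weylS_fixed hm hp hb.1 hb.2]

/-- Roots of level between `2` and `k - 1`, or of level `k` and joining two moved points. -/
lemma exists_isLevel_of_mem {l l' m p k : ℕ} (hm : m = (l' - 1) / 2) (hp : p = l - l') {v : V}
    (hk : 2 ≤ k)
    (h : (∃ i, 2 ≤ i ∧ i ≤ k - 1 ∧ v ∈ DeltaKk l (weylS l l') i) ∨
      v ∈ DeltaKk l (weylS l l') k ∩ DeltaO l (weylS l l')) :
    ∃ a b i, v = rt a b ∧ 1 ≤ i ∧ IsLevel l m p (weylS l l') i a b ∧ (i < k ∨ i = k ∧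
      ¬ (m + 2 ≤ a ∧ a ≤ m + p + 1) ∧ ¬ (m + 2 ≤ b ∧ b ≤ m + p + 1)) := by
  rcases h with ⟨i, h2, hi, hv⟩ | ⟨hv, hO⟩
  · obtain ⟨a, b, rfl, hab⟩ := exists_isLevel hm hp hv
    exact ⟨a, b, i, rfl, by omega, hab, Or.inl (by omega)⟩
  · obtain ⟨a, b, rfl, hab⟩ := exists_isLevel hm hp hv
    exact ⟨a, b, k, rfl, by omega, hab,
      Or.inr ⟨rfl, not_fixed_of_mem_DeltaO hm hp hab.lt.ne hO⟩⟩

/-- The constraints that a root of level `k` puts on the angles `t`, `u` of its end points, where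
`A`, `B` say whether the end points are fixed by `s`. -/
def LevelAngles (m l' k : ℕ) (A B : Prop) (t u : ℤ) : Prop :=
  (¬ A ∧ ¬ B ∧ t < u ∧ 4 * (k : ℤ) - 4 < t + u - 1 ∧ t + u - 1 < 4 * k) ∨
  (¬ A ∧ ¬ B ∧ u < t ∧ t + u - 1 < 0 ∧ 4 * (k : ℤ) - 4 < t + u - 1 + 2 * (l' + 1) ∧
    t + u - 1 + 2 * (l' + 1) < 4 * k) ∨
  (¬ A ∧ B ∧ -(m : ℤ) ≤ t - 2 * (k - 1) ∧ t - 2 * k < -m ∧ t ≤ m + 1) ∨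
  (A ∧ ¬ B ∧ (m : ℤ) + 2 ≤ u ∧ (m : ℤ) + 2 ≤ u - 2 * (k - 1) ∧ u - 2 * k < m + 2) ∨
  (A ∧ ¬ B ∧ u ≤ -(m : ℤ) - 1 ∧ (m : ℤ) + 2 ≤ u + 2 * (l' + 1) - 2 * (k - 1) ∧
    u + 2 * (l' + 1) - 2 * k < m + 2)

lemma IsLevel.levelAngles {l l' m p k a b : ℕ} (h5 : 5 ≤ l') (hll : l' ≤ l)
    (hm : m = (l' - 1) / 2) (hp : p = l - l') (hk : 1 ≤ k)
    (h : IsLevel l m p (weylS l l') k a b) :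
    LevelAngles m l' k (m + 2 ≤ a ∧ a ≤ m + p + 1) (m + 2 ≤ b ∧ b ≤ m + p + 1)
      (angle m p a) (angle m p b) := by
  unfold LevelAngles
  by_cases hb : m + 2 ≤ b ∧ b ≤ m + p + 1
  · obtain ⟨ha, h'⟩ := h.angle_left h5 hll hm hp hk hb
    exact Or.inr (Or.inr (Or.inl ⟨ha, hb, h'⟩))
  by_cases ha : m + 2 ≤ a ∧ a ≤ m + p + 1
  · obtain ⟨-, h' | h'⟩ := h.angle_right h5 hll hm hp hk ha
    · exact Or.inr (Or.inr (Or.inr (Or.inl ⟨ha, hb, h'⟩)))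
    · exact Or.inr (Or.inr (Or.inr (Or.inr ⟨ha, hb, h'⟩)))
  rcases h.angle_moved h5 hll hm hp hk ha hb with h' | h'
  · exact Or.inl ⟨ha, hb, h'⟩
  · exact Or.inr (Or.inl ⟨ha, hb, h'⟩)

/-- The range and parity of the angle `t` of a point, `A` saying whether `s` fixes that point. -/
def AngleRange (m l' : ℕ) (A : Prop) (t : ℤ) : Prop :=
  ¬ A → -((l' : ℤ) + 1) < t ∧ t ≤ l' + 1 ∧ (t - (m + 1)) % 2 = 0

section Chains

variable {m l' k i j : ℕ} {A B C X : Prop} {a b c x : ℤ}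

lemma not_levelAngles_row_row (hm : m = (l' - 1) / 2) (h5 : 5 ≤ l')
    (ha : AngleRange m l' A a) (hb : AngleRange m l' B b) (hc : AngleRange m l' C c)
    (hx : AngleRange m l' X x) (hj1 : 1 ≤ j) (hi1 : 1 ≤ i)
    (hi : i < k ∨ i = k ∧ ¬ A ∧ ¬ C) (hj : j < k ∨ j = k ∧ ¬ X ∧ ¬ A)
    (h : LevelAngles m l' k A B a b) (h₁ : LevelAngles m l' k C B c b)
    (h₂ : LevelAngles m l' i A C a c) (h₃ : LevelAngles m l' j X A x a)
    (h' : LevelAngles m l' k X B x b) : False := by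
  unfold LevelAngles AngleRange at *
  by_cases hA : A <;> by_cases hB : B <;> by_cases hC : C <;> by_cases hX : X <;>
    simp only [hA, hB, hC, hX, not_true_eq_false, not_false_eq_true, true_and, false_and,
      and_true, and_false, or_false, false_or, true_imp_iff, false_imp_iff] at * <;>
    omega

lemma not_levelAngles_row_col (hm : m = (l' - 1) / 2) (h5 : 5 ≤ l')
    (ha : AngleRange m l' A a) (hb : AngleRange m l' B b) (hc : AngleRange m l' C c)
    (hx : AngleRange m l' X x) (hj1 : 1 ≤ j) (hi1 : 1 ≤ i)
    (hi : i < k ∨ i = k ∧ ¬ A ∧ ¬ C) (hj : j < k ∨ j = k ∧ ¬ B ∧ ¬ X)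
    (h : LevelAngles m l' k A B a b) (h₁ : LevelAngles m l' k C B c b)
    (h₂ : LevelAngles m l' i A C a c) (h₃ : LevelAngles m l' j B X b x)
    (h' : LevelAngles m l' k A X a x) : False := by
  unfold LevelAngles AngleRange at *
  by_cases hA : A <;> by_cases hB : B <;> by_cases hC : C <;> by_cases hX : X <;>
    simp only [hA, hB, hC, hX, not_true_eq_false, not_false_eq_true, true_and, false_and,
      and_true, and_false, or_false, false_or, true_imp_iff, false_imp_iff] at * <;>
    omega

lemma not_levelAngles_col_row (hm : m = (l' - 1) / 2) (h5 : 5 ≤ l')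
    (ha : AngleRange m l' A a) (hb : AngleRange m l' B b) (hc : AngleRange m l' C c)
    (hx : AngleRange m l' X x) (hj1 : 1 ≤ j) (hi1 : 1 ≤ i)
    (hi : i < k ∨ i = k ∧ ¬ C ∧ ¬ B) (hj : j < k ∨ j = k ∧ ¬ X ∧ ¬ A)
    (h : LevelAngles m l' k A B a b) (h₁ : LevelAngles m l' k A C a c)
    (h₂ : LevelAngles m l' i C B c b) (h₃ : LevelAngles m l' j X A x a)
    (h' : LevelAngles m l' k X B x b) : False := by
  unfold LevelAngles AngleRange at *
  by_cases hA : A <;> by_cases hB : B <;> by_cases hC : C <;> by_cases hX : X <;>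
    simp only [hA, hB, hC, hX, not_true_eq_false, not_false_eq_true, true_and, false_and,
      and_true, and_false, or_false, false_or, true_imp_iff, false_imp_iff] at * <;>
    omega

lemma not_levelAngles_col_col (hm : m = (l' - 1) / 2) (h5 : 5 ≤ l')
    (ha : AngleRange m l' A a) (hb : AngleRange m l' B b) (hc : AngleRange m l' C c)
    (hx : AngleRange m l' X x) (hj1 : 1 ≤ j) (hi1 : 1 ≤ i)
    (hi : i < k ∨ i = k ∧ ¬ C ∧ ¬ B) (hj : j < k ∨ j = k ∧ ¬ B ∧ ¬ X)
    (h : LevelAngles m l' k A B a b) (h₁ : LevelAngles m l' k A C a c)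
    (h₂ : LevelAngles m l' i C B c b) (h₃ : LevelAngles m l' j B X b x)
    (h' : LevelAngles m l' k A X a x) : False := by
  unfold LevelAngles AngleRange at *
  by_cases hA : A <;> by_cases hB : B <;> by_cases hC : C <;> by_cases hX : X <;>
    simp only [hA, hB, hC, hX, not_true_eq_false, not_false_eq_true, true_and, false_and,
      and_true, and_false, or_false, false_or, true_imp_iff, false_imp_iff] at * <;>
    omega

end Chains

lemma IsLevel.angleRange {l l' m p k a b : ℕ} (h5 : 5 ≤ l') (hll : l' ≤ l)
    (hm : m = (l' - 1) / 2) (hp : p = l - l') (h : IsLevel l m p (weylS l l') k a b) :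
    AngleRange m l' (m + 2 ≤ a ∧ a ≤ m + p + 1) (angle m p a) ∧
      AngleRange m l' (m + 2 ≤ b ∧ b ≤ m + p + 1) (angle m p b) :=
  ⟨angle_bounds h5 hll hm hp h.one_le (h.lt.le.trans h.le),
    angle_bounds h5 hll hm hp (h.one_le.trans h.lt.le) h.le⟩

/-- for k ≥ 2, η, η₁ ∈ Δ̄_K^k and η₂ ∈ (Δ̄_K^2 ∪ ⋯ ∪ Δ̄_K^{k−1}) ∪
(Δ̄_K^k ∩ Δ^O) with η = η₁ + η₂: if η₃ lies in the same union and η + η₃ ∈ Δ, then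
η + η₃ ∉ Δ̄_K^k. -/
theorem stmt17 (l l' m p : ℕ) (h5 : 5 ≤ l') (hll : l' ≤ l)
    (hm : m = (l' - 1) / 2) (hp : p = l - l') :
    let s := weylS l l'
    ∀ k, 2 ≤ k → ∀ η ∈ DeltaKk l s k, ∀ η₁ ∈ DeltaKk l s k,
      ∀ η₂, ((∃ i, 2 ≤ i ∧ i ≤ k - 1 ∧ η₂ ∈ DeltaKk l s i) ∨
          η₂ ∈ DeltaKk l s k ∩ DeltaO l s) →
        η = η₁ + η₂ →
        ∀ η₃, ((∃ i, 2 ≤ i ∧ i ≤ k - 1 ∧ η₃ ∈ DeltaKk l s i) ∨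
            η₃ ∈ DeltaKk l s k ∩ DeltaO l s) →
          η + η₃ ∈ Delta l → η + η₃ ∉ DeltaKk l s k := by
  intro s k hk η hη η₁ hη₁ η₂ hη₂ hsum η₃ hη₃ _ hmem
  obtain ⟨a, b, rfl, h⟩ := exists_isLevel hm hp hη
  obtain ⟨a₁, b₁, rfl, h₁⟩ := exists_isLevel hm hp hη₁
  obtain ⟨a₂, b₂, i, rfl, hi1, h₂, hi⟩ := exists_isLevel_of_mem hm hp hk hη₂
  obtain ⟨a₃, b₃, j, rfl, hj1, h₃, hj⟩ := exists_isLevel_of_mem hm hp hk hη₃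
  obtain ⟨a', b', hsum', h'⟩ := exists_isLevel hm hp hmem
  have hk1 : 1 ≤ k := by omega
  obtain ⟨ra, rb⟩ := h.angleRange h5 hll hm hp
  obtain ⟨ra₂, rb₂⟩ := h₂.angleRange h5 hll hm hp
  obtain ⟨ra₃, rb₃⟩ := h₃.angleRange h5 hll hm hp
  have e := h.levelAngles h5 hll hm hp hk1
  have e₁ := h₁.levelAngles h5 hll hm hp hk1
  have e₂ := h₂.levelAngles h5 hll hm hp hi1
  have e₃ := h₃.levelAngles h5 hll hm hp hj1
  have e' := h'.levelAngles h5 hll hm hp hk1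
  rcases rt_add_rt h₁.lt.ne h₂.lt.ne h.lt.ne hsum with ⟨rfl, rfl, rfl⟩ | ⟨rfl, rfl, rfl⟩ <;>
    rcases rt_add_rt h.lt.ne h₃.lt.ne h'.lt.ne hsum'.symm with
      ⟨rfl, rfl, rfl⟩ | ⟨rfl, rfl, rfl⟩
  · exact not_levelAngles_col_col hm h5 ra rb ra₂ rb₃ hj1 hi1 hi hj e e₁ e₂ e₃ e'
  · exact not_levelAngles_col_row hm h5 ra rb ra₂ ra₃ hj1 hi1 hi hj e e₁ e₂ e₃ e'
  · exact not_levelAngles_row_col hm h5 ra rb rb₂ rb₃ hj1 hi1 hi hj e e₁ e₂ e₃ e'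
  · exact not_levelAngles_row_row hm h5 ra rb rb₂ ra₃ hj1 hi1 hi hj e e₁ e₂ e₃ e'
end DPW
end
end
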